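/- Let 𝒜 be of nonstandard p(·)-growth with constants a₋, b⁺. Suppose there exist δ > 0 and an increasing sequence of radii R_k → ∞ such that ess inf_{B_{2R_k}∖B_{R_k}} p ≥ n + δ for every k. If u is a bounded 𝒜-harmonic function in ℝⁿ, then u is constant. -/

import Mathlib

open MeasureTheory Metric Real
open scoped ContDiff

noncomputable section

abbrev Euc (n : ℕ) := EuclideanSpace ℝ (Fin n)

/-- Measure of the unit ball in `ℝⁿ`. -/
def omegaEuc (n : ℕ) : ℝ := (volume (Metric.ball (0 : Euc n) 1)).toReal

/-- A measurable variable exponent `p` with `p⁻ = pm` and `p⁺ = pP`,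
`1 < p⁻` and `p⁺ < ∞` (encoded by the a.e. bounds). -/
structure IsVarExp {n : ℕ} (p : Euc n → ℝ) (pm pP : ℝ) : Prop where
  meas : Measurable p
  one_lt : 1 < pm
  inf_eq : essInf p (volume : Measure (Euc n)) = pm
  sup_eq : essSup p (volume : Measure (Euc n)) = pP
  ae_lb : ∀ᵐ x ∂(volume : Measure (Euc n)), pm ≤ p x
  ae_ub : ∀ᵐ x ∂(volume : Measure (Euc n)), p x ≤ pP

/-- `𝒜` is of nonstandard `p(·)`-growth with constants `am = a₋`, `bP = b⁺`. -/
structure IsNSGrowth {n : ℕ} (p : Euc n → ℝ) (𝒜 : Euc n → ℝ → Euc n → Euc n)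
    (am bP : ℝ) : Prop where
  am_pos : 0 < am
  meas : ∀ (t : ℝ) (ξ : Euc n), Measurable (fun x => 𝒜 x t ξ)
  cont : ∀ x : Euc n, Continuous (fun tξ : ℝ × Euc n => 𝒜 x tξ.1 tξ.2)
  growth : ∃ a b : Euc n → ℝ, Measurable a ∧ Measurable b ∧
      (∀ x, am ≤ a x ∧ a x ≤ b x ∧ b x ≤ bP) ∧
      (∀ x t ξ, a x * ‖ξ‖ ^ p x ≤ (inner ℝ (𝒜 x t ξ) ξ : ℝ)) ∧
      (∀ x t ξ, ‖𝒜 x t ξ‖ ≤ b x * ‖ξ‖ ^ (p x - 1))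

/-- `u` is `𝒜`-harmonic in `ℝⁿ` (C¹ functions replace `W^{1,p(·)}_loc`). -/
def IsAHarmonic {n : ℕ} (p : Euc n → ℝ) (𝒜 : Euc n → ℝ → Euc n → Euc n)
    (u : Euc n → ℝ) : Prop :=
  ContDiff ℝ 1 u ∧
  LocallyIntegrable (fun x => ‖gradient u x‖ ^ p x) (volume : Measure (Euc n)) ∧
  ∀ φ : Euc n → ℝ, ContDiff ℝ ∞ φ → HasCompactSupport φ →
    ∫ x, (inner ℝ (𝒜 x (u x) (gradient u x)) (gradient φ x) : ℝ) = 0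

/-- `u` is an `𝒜`-subsolution in `ℝⁿ`. -/
def IsASubsolution {n : ℕ} (p : Euc n → ℝ) (𝒜 : Euc n → ℝ → Euc n → Euc n)
    (u : Euc n → ℝ) : Prop :=
  ContDiff ℝ 1 u ∧
  LocallyIntegrable (fun x => ‖gradient u x‖ ^ p x) (volume : Measure (Euc n)) ∧
  ∀ φ : Euc n → ℝ, ContDiff ℝ ∞ φ → HasCompactSupport φ → (∀ x, 0 ≤ φ x) →
    ∫ x, (inner ℝ (𝒜 x (u x) (gradient u x)) (gradient φ x) : ℝ) ≤ 0

/-- `ℬ` is an admissible right-hand side. -/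
structure IsAdmissibleRHS {n : ℕ} (p : Euc n → ℝ) (ℬ : Euc n → ℝ → Euc n → ℝ) : Prop where
  meas : ∀ (t : ℝ) (ξ : Euc n), Measurable (fun x => ℬ x t ξ)
  cont : ∀ x : Euc n, Continuous (fun tξ : ℝ × Euc n => ℬ x tξ.1 tξ.2)
  bound : ∃ c : Euc n → ℝ, Measurable c ∧ (∃ cP : ℝ, ∀ x, c x ≤ cP) ∧
      ∀ x t ξ, |ℬ x t ξ| ≤ c x * (1 + ‖ξ‖ ^ (p x - 1))

/-- `u` is `(𝒜,ℬ)`-harmonic in `ℝⁿ`. -/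
def IsABHarmonic {n : ℕ} (p : Euc n → ℝ) (𝒜 : Euc n → ℝ → Euc n → Euc n)
    (ℬ : Euc n → ℝ → Euc n → ℝ) (u : Euc n → ℝ) : Prop :=
  ContDiff ℝ 1 u ∧
  LocallyIntegrable (fun x => ‖gradient u x‖ ^ p x) (volume : Measure (Euc n)) ∧
  ∀ φ : Euc n → ℝ, ContDiff ℝ ∞ φ → HasCompactSupport φ →
    ∫ x, (inner ℝ (𝒜 x (u x) (gradient u x)) (gradient φ x) : ℝ)
      = ∫ x, ℬ x (u x) (gradient u x) * φ x

/-- `u` is a supersolution of `div 𝒜(x,u,∇u) = f(u)` in `ℝⁿ`. -/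
def IsFSupersolution {n : ℕ} (p : Euc n → ℝ) (𝒜 : Euc n → ℝ → Euc n → Euc n)
    (f : ℝ → ℝ) (u : Euc n → ℝ) : Prop :=
  ContDiff ℝ 1 u ∧
  LocallyIntegrable (fun x => ‖gradient u x‖ ^ p x) (volume : Measure (Euc n)) ∧
  ∀ φ : Euc n → ℝ, ContDiff ℝ ∞ φ → HasCompactSupport φ → (∀ x, 0 ≤ φ x) →
    ∫ x, f (u x) * φ x ≤ - ∫ x, (inner ℝ (𝒜 x (u x) (gradient u x)) (gradient φ x) : ℝ)


open scoped Convolution in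
/-- A compactly supported `C¹` function is approximated, uniformly in its derivative, by smooth
functions supported in a fixed ball. -/
theorem exists_contDiff_fderiv_sub_le {n : ℕ} {φ : Euc n → ℝ} (hφ : ContDiff ℝ 1 φ)
    (hcs : HasCompactSupport φ) :
    ∃ S : ℝ, (∀ x, S ≤ ‖x‖ → fderiv ℝ φ x = 0) ∧ ∀ ε > 0, ∃ ψ : Euc n → ℝ,
      ContDiff ℝ ∞ ψ ∧ HasCompactSupport ψ ∧ (∀ x, S ≤ ‖x‖ → fderiv ℝ ψ x = 0) ∧
      ∀ x, ‖fderiv ℝ ψ x - fderiv ℝ φ x‖ ≤ ε := by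
  obtain ⟨S, hS⟩ := hcs.isCompact.isBounded.subset_closedBall (0 : Euc n)
  have hvanish : ∀ x, S + 2 ≤ ‖x‖ → fderiv ℝ φ x = 0 := by
    intro x hx
    refine image_eq_zero_of_notMem_tsupport fun h => ?_
    have := hS (tsupport_fderiv_subset ℝ h)
    rw [mem_closedBall_zero_iff] at this
    linarith
  refine ⟨S + 2, hvanish, fun ε hε => ?_⟩
  have hcd : Continuous (fderiv ℝ φ) := hφ.continuous_fderiv one_ne_zero
  obtain ⟨r, hr, hru⟩ := Metric.uniformContinuous_iff.1
    ((hcs.fderiv ℝ).uniformContinuous_of_continuous hcd) ε hε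
  have hm : 0 < min r 1 := lt_min hr one_pos
  let β : ContDiffBump (0 : Euc n) := ⟨min r 1 / 2, min r 1, half_pos hm, half_lt_self hm⟩
  have hβ : β.rOut = min r 1 := rfl
  have hderiv : ∀ x, HasFDerivAt (β.normed volume ⋆[ContinuousLinearMap.lsmul ℝ ℝ, volume] φ)
      ((β.normed volume ⋆[ContinuousLinearMap.lsmul ℝ ℝ, volume] fderiv ℝ φ) x) x := fun x =>
    hcs.hasFDerivAt_convolution_right (ContinuousLinearMap.lsmul ℝ ℝ)
      β.continuous_normed.locallyIntegrable hφ x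
  have hsupp : ∀ x, S + 1 < ‖x‖ →
      (β.normed volume ⋆[ContinuousLinearMap.lsmul ℝ ℝ, volume] φ) x = 0 := by
    intro x hx
    by_contra h
    obtain ⟨y, hy, z, hz, rfl⟩ := support_convolution_subset_swap
      (ContinuousLinearMap.lsmul ℝ ℝ) (μ := volume) (show x ∈ Function.support _ from h)
    have h1 := hS (subset_tsupport _ hy)
    rw [β.support_normed_eq, mem_ball_zero_iff, hβ] at hz
    rw [mem_closedBall_zero_iff] at h1
    have := norm_add_le y z
    have := min_le_right r 1
    linarith
  refine ⟨β.normed volume ⋆[ContinuousLinearMap.lsmul ℝ ℝ, volume] φ,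
    β.hasCompactSupport_normed.contDiff_convolution_left _ β.contDiff_normed
      hφ.continuous.locallyIntegrable, ?_, ?_, ?_⟩
  · exact HasCompactSupport.of_support_subset_isCompact (isCompact_closedBall (0 : Euc n) (S + 1))
      fun x hx => by
        rw [mem_closedBall_zero_iff]
        by_contra h
        exact hx (hsupp x (not_le.1 h))
  · intro x hx
    have : (β.normed volume ⋆[ContinuousLinearMap.lsmul ℝ ℝ, volume] φ) =ᶠ[nhds x]
        fun _ => (0 : ℝ) := by
      filter_upwards [continuous_norm.continuousAt.eventually
        (lt_mem_nhds (show S + 1 < ‖x‖ by linarith))] with y hy using hsupp y hy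
    rw [this.fderiv_eq]
    simp
  · intro x
    rw [(hderiv x).fderiv, ← dist_eq_norm]
    refine β.dist_normed_convolution_le hcd.aestronglyMeasurable fun y hy => (hru ?_).le
    rw [mem_ball, hβ] at hy
    exact hy.trans_le (min_le_left _ _)

/-- A locally integrable field orthogonal to the derivatives of smooth compactly supported
functions is orthogonal to those of `C¹` compactly supported functions. -/
theorem integral_fderiv_apply_eq_zero {n : ℕ} {F : Euc n → Euc n}
    (hF : LocallyIntegrable F (volume : Measure (Euc n)))
    (h : ∀ φ : Euc n → ℝ, ContDiff ℝ ∞ φ → HasCompactSupport φ → ∫ x, fderiv ℝ φ x (F x) = 0)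
    {φ : Euc n → ℝ} (hφ : ContDiff ℝ 1 φ) (hcs : HasCompactSupport φ) :
    Integrable (fun x => fderiv ℝ φ x (F x)) ∧ ∫ x, fderiv ℝ φ x (F x) = 0 := by
  have hint : ∀ ψ : Euc n → ℝ, ContDiff ℝ 1 ψ → HasCompactSupport ψ →
      Integrable (fun x => fderiv ℝ ψ x (F x)) := by
    intro ψ hψ hψc
    have hc : Continuous (fderiv ℝ ψ) := hψ.continuous_fderiv one_ne_zero
    obtain ⟨C, hC⟩ := (hψc.fderiv ℝ).exists_bound_of_continuous hc
    have hK : IsCompact (tsupport (fderiv ℝ ψ)) := hψc.fderiv ℝ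
    have hFK := (hF.integrableOn_isCompact hK).norm
    have h1 : IntegrableOn (fun x => fderiv ℝ ψ x (F x)) (tsupport (fderiv ℝ ψ)) := by
      refine (hFK.const_mul C).mono' ?_ (Filter.Eventually.of_forall fun x => ?_)
      · exact (ContinuousLinearMap.aestronglyMeasurable_comp₂ (ContinuousLinearMap.id ℝ _)
          hc.aestronglyMeasurable hF.aestronglyMeasurable).restrict
      · exact (ContinuousLinearMap.le_opNorm _ _).trans (by gcongr; exact hC x)
    refine (integrableOn_iff_integrable_of_support_subset fun x hx => ?_).1 h1
    by_contra hx'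
    exact hx (by simp [image_eq_zero_of_notMem_tsupport hx'])
  refine ⟨hint φ hφ hcs, ?_⟩
  obtain ⟨S, hS, happ⟩ := exists_contDiff_fderiv_sub_le hφ hcs
  have hFS := (hF.integrableOn_isCompact (isCompact_closedBall (0 : Euc n) S)).norm
  have hle : ∀ ε > 0, |∫ x, fderiv ℝ φ x (F x)| ≤ ε * ∫ x in closedBall 0 S, ‖F x‖ := by
    intro ε hε
    obtain ⟨ψ, hψ, hψc, hψS, hψε⟩ := happ ε hε
    have hψ1 : ContDiff ℝ 1 ψ := hψ.of_le (by exact_mod_cast le_top)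
    have heq : ∫ x, fderiv ℝ φ x (F x)
        = ∫ x in closedBall 0 S, (fderiv ℝ φ x (F x) - fderiv ℝ ψ x (F x)) := by
      rw [setIntegral_eq_integral_of_forall_compl_eq_zero,
        integral_sub (hint φ hφ hcs) (hint ψ hψ1 hψc), h ψ hψ hψc, sub_zero]
      intro x hx
      rw [mem_closedBall_zero_iff, not_le] at hx
      simp [hS x hx.le, hψS x hx.le]
    rw [heq, ← Real.norm_eq_abs, ← integral_const_mul]
    refine norm_integral_le_of_norm_le (hFS.const_mul ε) (Filter.Eventually.of_forall fun x => ?_)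
    rw [← sub_apply]
    refine (ContinuousLinearMap.le_opNorm _ _).trans ?_
    gcongr
    rw [norm_sub_rev]
    exact hψε x
  set I := ∫ x in closedBall 0 S, ‖F x‖
  have hI : 0 ≤ I := integral_nonneg fun _ => norm_nonneg _
  rw [← abs_eq_zero]
  refine le_antisymm (le_of_forall_pos_le_add fun ε hε => ?_) (abs_nonneg _)
  refine (hle (ε / (I + 1)) (by positivity)).trans ?_
  rw [zero_add, div_mul_eq_mul_div, div_le_iff₀ (by positivity)]
  nlinarith

/-- Smooth cutoffs between `B_r` and `B_{2r}` with derivative of order `1 / r`. -/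
theorem exists_cutoff (n : ℕ) : ∃ C : ℝ, 0 < C ∧ ∀ r > 0, ∃ η : Euc n → ℝ,
    ContDiff ℝ 1 η ∧ HasCompactSupport η ∧ (∀ x, 0 ≤ η x) ∧ (∀ x, η x ≤ 1) ∧
    (∀ x ∈ ball 0 r, η x = 1) ∧ (∀ x ∈ ball 0 r, fderiv ℝ η x = 0) ∧
    (∀ x ∉ ball 0 (2 * r), fderiv ℝ η x = 0) ∧ ∀ x, ‖fderiv ℝ η x‖ ≤ C / r := by
  let f : ContDiffBump (0 : Euc n) := ⟨1, 3 / 2, one_pos, by norm_num⟩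
  have hf1 : ContDiff ℝ 1 f := f.contDiff
  obtain ⟨C, hC⟩ := (f.hasCompactSupport.fderiv ℝ).exists_bound_of_continuous
    (hf1.continuous_fderiv one_ne_zero)
  refine ⟨max C 1, by positivity, fun r hr => ⟨fun x => f (r⁻¹ • x), ?_⟩⟩
  have hd : ∀ x, fderiv ℝ (fun x => f (r⁻¹ • x)) x = r⁻¹ • fderiv ℝ f (r⁻¹ • x) := fun x =>
    fderiv_comp_smul _
  have hnorm : ∀ x : Euc n, ‖r⁻¹ • x‖ = ‖x‖ / r := fun x => by
    rw [norm_smul, Real.norm_of_nonneg (by positivity), div_eq_inv_mul]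
  refine ⟨hf1.comp (contDiff_const_smul _), f.hasCompactSupport.comp_smul (by positivity),
    fun x => f.nonneg, fun x => f.le_one, fun x hx => ?_, fun x hx => ?_, fun x hx => ?_,
    fun x => ?_⟩
  · refine f.one_of_mem_closedBall ?_
    rw [mem_ball_zero_iff] at hx
    rw [mem_closedBall_zero_iff, hnorm]
    exact (div_le_one hr).2 hx.le
  · rw [mem_ball_zero_iff] at hx
    rw [hd, (f.eventuallyEq_one_of_mem_ball ?_).fderiv_eq]
    · simp
    · rw [mem_ball_zero_iff, hnorm]
      exact (div_lt_one hr).2 hx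
  · rw [mem_ball_zero_iff, not_lt] at hx
    rw [hd, image_eq_zero_of_notMem_tsupport (f := fderiv ℝ f), smul_zero]
    intro h
    have h2 := tsupport_fderiv_subset ℝ h
    rw [f.tsupport_eq, mem_closedBall_zero_iff, hnorm, div_le_iff₀ hr] at h2
    have : f.rOut = 3 / 2 := rfl
    rw [this] at h2
    linarith
  · rw [hd, norm_smul, Real.norm_of_nonneg (by positivity), inv_mul_eq_div]
    gcongr
    exact (hC _).trans (le_max_left _ _)

/-- Young-type absorption of the cutoff error term. -/
theorem cutoff_error_le {K η s t q : ℝ} {N : ℕ} (hK : 0 ≤ K) (hη : 0 ≤ η) (hη1 : η ≤ 1)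
    (hs : 0 ≤ s) (ht : 0 ≤ t) (hq : 1 < q) (hqN : q ≤ N + 1) :
    K * s * (η ^ N * t ^ (q - 1)) ≤ η ^ (N + 1) * t ^ q + (K * s) ^ q := by
  have hKs : 0 ≤ K * s := mul_nonneg hK hs
  have key : ∀ y : ℝ, 0 ≤ y → y * y ^ (q - 1) = y ^ q := fun y hy => by
    rw [← Real.rpow_one_add' hy (by linarith)]
    ring_nf
  rcases le_total (K * s) (η * t) with h | h
  · calc K * s * (η ^ N * t ^ (q - 1)) ≤ η * t * (η ^ N * t ^ (q - 1)) := by gcongr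
      _ = η ^ (N + 1) * t ^ q := by rw [← key t ht]; ring
      _ ≤ _ := le_add_of_nonneg_right (by positivity)
  · have h1 : η ^ N * t ^ (q - 1) ≤ (K * s) ^ (q - 1) := by
      calc η ^ N * t ^ (q - 1) ≤ η ^ (q - 1) * t ^ (q - 1) := by
            gcongr
            rw [← Real.rpow_natCast]
            exact Real.rpow_le_rpow_of_exponent_ge' hη hη1 (by linarith) (by linarith)
        _ = (η * t) ^ (q - 1) := (Real.mul_rpow hη ht).symm
        _ ≤ _ := by gcongr
    calc K * s * (η ^ N * t ^ (q - 1)) ≤ K * s * (K * s) ^ (q - 1) := by gcongr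
      _ = (K * s) ^ q := key _ hKs
      _ ≤ _ := le_add_of_nonneg_left (by positivity)

theorem norm_gradient_eq_norm_fderiv {n : ℕ} (u : Euc n → ℝ) (x : Euc n) :
    ‖gradient u x‖ = ‖fderiv ℝ u x‖ := by
  rw [gradient, LinearIsometryEquiv.norm_map]

/-- The flux `𝒜(x, u, ∇u)` of a `C¹` function is locally integrable. -/
theorem IsNSGrowth.locallyIntegrable_flux {n : ℕ} {p : Euc n → ℝ} {pm pP : ℝ}
    (hp : IsVarExp p pm pP) {𝒜 : Euc n → ℝ → Euc n → Euc n} {am bP : ℝ}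
    (h𝒜 : IsNSGrowth p 𝒜 am bP) {u : Euc n → ℝ} (hu : ContDiff ℝ 1 u) :
    LocallyIntegrable (fun x => 𝒜 x (u x) (gradient u x)) (volume : Measure (Euc n)) := by
  have hg : Continuous (gradient u) :=
    (InnerProductSpace.toDual ℝ (Euc n)).symm.continuous.comp (hu.continuous_fderiv one_ne_zero)
  have hmeas : Measurable (fun x => 𝒜 x (u x) (gradient u x)) :=
    (measurable_uncurry_of_continuous_of_measurable
      (u := fun (tξ : ℝ × Euc n) (x : Euc n) => 𝒜 x tξ.1 tξ.2) h𝒜.cont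
      fun tξ => h𝒜.meas tξ.1 tξ.2).comp
      ((hu.continuous.measurable.prodMk hg.measurable).prodMk measurable_id)
  obtain ⟨a, b, -, -, hab, -, hgrow⟩ := h𝒜.growth
  have hdom : LocallyIntegrable (fun x => bP * (1 + ‖gradient u x‖) ^ (pP - 1))
      (volume : Measure (Euc n)) := by
    refine Continuous.locallyIntegrable (continuous_const.mul ?_)
    exact (continuous_const.fun_add hg.norm).rpow_const fun x =>
      Or.inl (by positivity)
  refine hdom.mono hmeas.aestronglyMeasurable ?_
  filter_upwards [hp.ae_lb, hp.ae_ub] with x h1 h2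
  have hb : 0 ≤ b x := h𝒜.am_pos.le.trans ((hab x).1.trans (hab x).2.1)
  have hpm := hp.one_lt
  refine (hgrow x _ _).trans (le_trans ?_ (le_abs_self _))
  have h3 : ‖gradient u x‖ ^ (p x - 1) ≤ (1 + ‖gradient u x‖) ^ (pP - 1) :=
    (Real.rpow_le_rpow (norm_nonneg _) (by linarith) (by linarith)).trans
      (Real.rpow_le_rpow_of_exponent_le (by linarith [norm_nonneg (gradient u x)]) (by linarith))
  exact mul_le_mul (hab x).2.2 h3 (by positivity) (hb.trans (hab x).2.2)

/-- Caccioppoli-type estimate: the energy of a bounded `𝒜`-harmonic function on `B_r` is controlled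
by a lower bound `q` of the exponent on the annulus `B_{2r} ∖ B_r`. -/
theorem IsAHarmonic.exists_energy_le {n : ℕ} {p : Euc n → ℝ} {pm pP : ℝ}
    (hp : IsVarExp p pm pP) {𝒜 : Euc n → ℝ → Euc n → Euc n} {am bP : ℝ}
    (h𝒜 : IsNSGrowth p 𝒜 am bP) {u : Euc n → ℝ} (hu : IsAHarmonic p 𝒜 u)
    {M : ℝ} (hbdd : ∀ x, |u x| ≤ M) :
    ∃ K : ℝ, 0 ≤ K ∧ ∀ r q : ℝ, 0 < r → K ≤ r → 0 ≤ q →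
      (∀ᵐ x, x ∈ ball (0 : Euc n) (2 * r) \ ball 0 r → q ≤ p x) →
      ∫ x in ball 0 r, ‖gradient u x‖ ^ p x
        ≤ (K / r) ^ q * volume.real (ball (0 : Euc n) (2 * r)) := by
  obtain ⟨hu1, huint, hweak⟩ := hu
  obtain ⟨C, hC, hcut⟩ := exists_cutoff n
  obtain ⟨N, hN⟩ := exists_nat_ge pP
  have hM : 0 ≤ M := (abs_nonneg _).trans (hbdd 0)
  have ham := h𝒜.am_pos
  have hF := h𝒜.locallyIntegrable_flux hp hu1
  obtain ⟨a, b, -, -, hab, hcoer, hgrow⟩ := h𝒜.growth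
  have hbP : 0 ≤ bP := ham.le.trans ((hab 0).1.trans ((hab 0).2.1.trans (hab 0).2.2))
  set F : Euc n → Euc n := fun x => 𝒜 x (u x) (gradient u x) with hFdef
  set K : ℝ := 2 * (N + 1) * M * bP / am with hKdef
  have hK : 0 ≤ K := by positivity
  have hKam : (N + 1) * M * bP = am / 2 * K := by
    rw [hKdef]
    field_simp
  have hweak' : ∀ φ : Euc n → ℝ, ContDiff ℝ ∞ φ → HasCompactSupport φ →
      ∫ x, fderiv ℝ φ x (F x) = 0 := by
    intro φ h1 h2
    rw [← hweak φ h1 h2]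
    refine integral_congr_ae (Filter.Eventually.of_forall fun x => ?_)
    simp [hFdef, inner_gradient_right]
  refine ⟨K * C, by positivity, fun r q hr hKr hq hann => ?_⟩
  obtain ⟨η, hη, hηc, hη0, hη1, hηone, hd_in, hd_out, hd_le⟩ := hcut r hr
  set κ : ℝ := (K * C / r) ^ q with hκdef
  have hκ : 0 ≤ κ := by positivity
  have hv : ContDiff ℝ 1 (fun x => η x ^ (N + 1) * u x) := (hη.pow _).mul hu1
  have hvc : HasCompactSupport (fun x => η x ^ (N + 1) * u x) := by
    refine hηc.mono fun x hx hx' => hx ?_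
    simp [hx']
  obtain ⟨hvi, hv0⟩ := integral_fderiv_apply_eq_zero hF hweak' hv hvc
  have hfd : ∀ x, fderiv ℝ (fun x => η x ^ (N + 1) * u x) x (F x)
      = η x ^ (N + 1) * fderiv ℝ u x (F x)
        + (N + 1) * u x * η x ^ N * fderiv ℝ η x (F x) := by
    intro x
    have hηx := (hη.differentiable one_ne_zero x).hasFDerivAt
    have hux := (hu1.differentiable one_ne_zero x).hasFDerivAt
    rw [((hηx.pow (N + 1)).fun_mul hux).fderiv]
    simp
    ring
  have hball : MeasurableSet (ball (0 : Euc n) r) := measurableSet_ball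
  have hball2 : MeasurableSet (ball (0 : Euc n) (2 * r)) := measurableSet_ball
  have hI1 : IntegrableOn (fun x => ‖gradient u x‖ ^ p x) (ball (0 : Euc n) r) :=
    (huint.integrableOn_isCompact (isCompact_closedBall 0 r)).mono_set ball_subset_closedBall
  have hI2 : IntegrableOn (fun _ => κ) (ball (0 : Euc n) (2 * r)) :=
    integrableOn_const measure_ball_lt_top.ne
  have hpt : ∀ᵐ x, am / 2 * ((ball (0 : Euc n) r).indicator (fun x => ‖gradient u x‖ ^ p x) x
      - (ball (0 : Euc n) (2 * r)).indicator (fun _ => κ) x)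
      ≤ fderiv ℝ (fun x => η x ^ (N + 1) * u x) x (F x) := by
    filter_upwards [hp.ae_lb, hp.ae_ub, hann] with x hx1 hx2 hx3
    have hpx : 1 < p x := hp.one_lt.trans_le hx1
    set t := ‖gradient u x‖
    set s := ‖fderiv ℝ η x‖
    have ht : 0 ≤ t := norm_nonneg _
    have hs : 0 ≤ s := norm_nonneg _
    have hηN : 0 ≤ η x ^ N := pow_nonneg (hη0 x) _
    have hηN1 : 0 ≤ η x ^ (N + 1) := pow_nonneg (hη0 x) _
    have htp : 0 ≤ t ^ p x := Real.rpow_nonneg ht _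
    have hlow : am * t ^ p x ≤ fderiv ℝ u x (F x) := by
      have h1 := hcoer x (u x) (gradient u x)
      have h2 : inner ℝ (𝒜 x (u x) (gradient u x)) (gradient u x) = fderiv ℝ u x (F x) := by
        simp [hFdef, inner_gradient_right]
      rw [← h2]
      exact (mul_le_mul_of_nonneg_right (hab x).1 htp).trans h1
    have herr : |(N + 1) * u x * η x ^ N * fderiv ℝ η x (F x)|
        ≤ am / 2 * (η x ^ (N + 1) * t ^ p x + (K * s) ^ p x) := by
      have hFx : ‖F x‖ ≤ bP * t ^ (p x - 1) := (hgrow x _ _).trans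
        (mul_le_mul_of_nonneg_right (hab x).2.2 (Real.rpow_nonneg ht _))
      have h1 : |fderiv ℝ η x (F x)| ≤ s * (bP * t ^ (p x - 1)) :=
        (ContinuousLinearMap.le_opNorm _ _).trans (mul_le_mul_of_nonneg_left hFx hs)
      have hN0 : (0 : ℝ) ≤ N + 1 := by positivity
      rw [abs_mul, abs_mul, abs_mul, abs_of_nonneg hηN, abs_of_nonneg hN0]
      calc (N + 1) * |u x| * η x ^ N * |fderiv ℝ η x (F x)|
          ≤ (N + 1) * M * η x ^ N * (s * (bP * t ^ (p x - 1))) := by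
            gcongr
            exact hbdd x
        _ = (N + 1) * M * bP * (s * (η x ^ N * t ^ (p x - 1))) := by ring
        _ = am / 2 * (K * s * (η x ^ N * t ^ (p x - 1))) := by rw [hKam]; ring
        _ ≤ _ := by
            gcongr
            exact cutoff_error_le hK (hη0 x) (hη1 x) hs ht hpx (by linarith)
    have hin : (ball (0 : Euc n) r).indicator (fun x => ‖gradient u x‖ ^ p x) x
        ≤ η x ^ (N + 1) * t ^ p x := by
      by_cases hx : x ∈ ball 0 r
      · rw [Set.indicator_of_mem hx, hηone x hx, one_pow, one_mul]
      · rw [Set.indicator_of_notMem hx]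
        positivity
    have hout : (K * s) ^ p x ≤ (ball (0 : Euc n) (2 * r)).indicator (fun _ => κ) x := by
      by_cases hx : x ∈ ball (0 : Euc n) (2 * r) \ ball 0 r
      · rw [Set.indicator_of_mem hx.1]
        have hKC : K * C / r ≤ 1 := (div_le_one hr).2 hKr
        calc (K * s) ^ p x ≤ (K * C / r) ^ p x := by
              refine Real.rpow_le_rpow (by positivity) ?_ (by linarith)
              rw [mul_div_assoc]
              exact mul_le_mul_of_nonneg_left (hd_le x) hK
          _ ≤ κ := Real.rpow_le_rpow_of_exponent_ge' (by positivity) hKC hq (hx3 hx)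
      · have hs0 : s = 0 := by
          by_cases hx' : x ∈ ball (0 : Euc n) r
          · simp [s, hd_in x hx']
          · simp [s, hd_out x fun h => hx ⟨h, hx'⟩]
        rw [hs0, mul_zero, Real.zero_rpow (by linarith)]
        exact Set.indicator_nonneg (fun _ _ => hκ) x
    rw [hfd x]
    have h1 := neg_abs_le ((N + 1) * u x * η x ^ N * fderiv ℝ η x (F x))
    have h2 := mul_le_mul_of_nonneg_left hlow hηN1
    have h3 : am / 2 * (ball (0 : Euc n) r).indicator (fun x => ‖gradient u x‖ ^ p x) x
        ≤ am / 2 * (η x ^ (N + 1) * t ^ p x) := by gcongr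
    have h4 : am / 2 * (K * s) ^ p x
        ≤ am / 2 * (ball (0 : Euc n) (2 * r)).indicator (fun _ => κ) x := by gcongr
    linarith
  have hmono := integral_mono_ae
    (((hI1.integrable_indicator hball).sub (hI2.integrable_indicator hball2)).const_mul (am / 2))
    hvi hpt
  rw [hv0, integral_const_mul] at hmono
  simp only [Pi.sub_apply] at hmono
  rw [integral_sub (hI1.integrable_indicator hball) (hI2.integrable_indicator hball2),
    integral_indicator hball, integral_indicator hball2, setIntegral_const, smul_eq_mul] at hmono
  have := nonpos_of_mul_nonpos_right hmono (by positivity)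
  rw [mul_comm κ]
  linarith

/-- Theorem 3.3: if `ess inf p ≥ n + δ` on annuli `B_{2R_k}∖B_{R_k}` with `R_k → ∞`,
then every bounded `𝒜`-harmonic function in `ℝⁿ` is constant. -/
theorem liouville_bounded_A_harmonic {n : ℕ} (p : Euc n → ℝ) (pm pP : ℝ)
    (hp : IsVarExp p pm pP)
    (𝒜 : Euc n → ℝ → Euc n → Euc n) (am bP : ℝ)
    (h𝒜 : IsNSGrowth p 𝒜 am bP)
    (δ : ℝ) (hδ : 0 < δ)
    (R : ℕ → ℝ) (hRmono : StrictMono R)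
    (hRtop : Filter.Tendsto R Filter.atTop Filter.atTop)
    (hann : ∀ k, (n : ℝ) + δ ≤
      essInf p (volume.restrict (Metric.ball (0 : Euc n) (2 * R k) \ Metric.ball 0 (R k))))
    (u : Euc n → ℝ) (hu : IsAHarmonic p 𝒜 u)
    (M : ℝ) (hbdd : ∀ x, |u x| ≤ M) :
    ∃ c : ℝ, ∀ x, u x = c := by
  have hu1 := hu.1
  obtain ⟨K, hK, hE⟩ := hu.exists_energy_le hp h𝒜 hbdd
  set V := volume.real (ball (0 : Euc n) 1)
  have hnonneg : ∀ x, 0 ≤ ‖gradient u x‖ ^ p x := fun x => Real.rpow_nonneg (norm_nonneg _) _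
  have hIon : ∀ r, IntegrableOn (fun x => ‖gradient u x‖ ^ p x) (ball (0 : Euc n) r) := fun r =>
    (hu.2.1.integrableOn_isCompact (isCompact_closedBall 0 r)).mono_set ball_subset_closedBall
  have hq : 0 ≤ (n : ℝ) + δ := by positivity
  have hbound : ∀ k, 0 < R k → K ≤ R k → ∫ x in ball 0 (R k), ‖gradient u x‖ ^ p x
      ≤ K ^ (n + δ) * 2 ^ n * V * R k ^ (-δ) := by
    intro k hk hKk
    refine (hE (R k) (n + δ) hk hKk hq ?_).trans_eq ?_
    · rw [← ae_restrict_iff' (measurableSet_ball.diff measurableSet_ball)]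
      filter_upwards [ae_essInf_le (f := p)
        (μ := volume.restrict (ball (0 : Euc n) (2 * R k) \ ball 0 (R k)))
        ⟨pm, ae_restrict_of_ae hp.ae_lb⟩] with x hx
      exact (hann k).trans hx
    · rw [measureReal_def, Measure.addHaar_ball_of_pos _ _ (by positivity), ENNReal.toReal_mul,
        ENNReal.toReal_ofReal (by positivity), finrank_euclideanSpace_fin, ← measureReal_def,
        Real.div_rpow hK hk.le, Real.rpow_neg hk.le, Real.rpow_add hk, Real.rpow_natCast, mul_pow]
      field_simp
      rfl
  have hlim : Filter.Tendsto (fun k => K ^ (n + δ) * 2 ^ n * V * R k ^ (-δ)) Filter.atTop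
      (nhds 0) := by
    simpa using ((tendsto_rpow_neg_atTop hδ).comp hRtop).const_mul (K ^ (n + δ) * 2 ^ n * V)
  have hzero : ∀ r, ∫ x in ball 0 r, ‖gradient u x‖ ^ p x = 0 := by
    intro r
    refine le_antisymm (ge_of_tendsto hlim ?_) (integral_nonneg hnonneg)
    filter_upwards [hRtop.eventually_gt_atTop 0, hRtop.eventually_ge_atTop K,
      hRtop.eventually_ge_atTop r] with k h0 h1 h2
    exact (setIntegral_mono_set (hIon _) (Filter.Eventually.of_forall hnonneg)
      (Filter.Eventually.of_forall (ball_subset_ball h2))).trans (hbound k h0 h1)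
  have hae : ∀ᵐ x, fderiv ℝ u x = 0 := by
    have h1 : ∀ m : ℕ, ∀ᵐ x, x ∈ ball (0 : Euc n) m → ‖gradient u x‖ ^ p x = 0 := fun m =>
      (ae_restrict_iff' measurableSet_ball).1
        ((setIntegral_eq_zero_iff_of_nonneg_ae (Filter.Eventually.of_forall hnonneg)
          (hIon m)).1 (hzero m))
    filter_upwards [ae_all_iff.2 h1, hp.ae_lb] with x hx hpx
    obtain ⟨m, hm⟩ := exists_nat_gt ‖x‖
    have h2 := hx m (mem_ball_zero_iff.2 hm)
    have hpx0 : p x ≠ 0 := by linarith [hp.one_lt]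
    rwa [Real.rpow_eq_zero (norm_nonneg _) hpx0, norm_gradient_eq_norm_fderiv, norm_eq_zero] at h2
  have hall : fderiv ℝ u = fun _ => 0 :=
    ((hu1.continuous_fderiv one_ne_zero).ae_eq_iff_eq volume continuous_const).1 hae
  exact ⟨u 0, fun x => is_const_of_fderiv_eq_zero (hu1.differentiable one_ne_zero)
    (fun y => congrFun hall y) x 0⟩

end
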